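/- arXiv:1412.8196 — 8 statements merged into one kernel-verified Lean document; each statement's English description precedes it below -/
import Mathlib

section
/- Two matrices A, B ∈ SL(2,ℂ) have a common eigenvector if and only if tr([A,B]) = 2. -/
open Matrix

/-- The trace of an element of `SL(2,ℂ)` viewed as a matrix. -/
noncomputable def tr (A : Matrix.SpecialLinearGroup (Fin 2) ℂ) : ℂ :=
  Matrix.trace (A : Matrix (Fin 2) (Fin 2) ℂ)

/-- `A` and `B` have a common eigenvector: a nonzero `v ∈ ℂ²` which is an
eigenvector of both. -/
def HasCommonEigenvector (A B : Matrix.SpecialLinearGroup (Fin 2) ℂ) : Prop :=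
  ∃ v : Fin 2 → ℂ, v ≠ 0 ∧ (∃ a : ℂ, (A : Matrix (Fin 2) (Fin 2) ℂ) *ᵥ v = a • v)
    ∧ (∃ b : ℂ, (B : Matrix (Fin 2) (Fin 2) ℂ) *ᵥ v = b • v)

/-- Every binary quadratic form over `ℂ` splits into linear factors. -/
lemma exists_linear_factors (p q r : ℂ) :
    ∃ α β γ δ : ℂ, p = α * γ ∧ q = α * δ + β * γ ∧ r = β * δ := by
  by_cases hp : p = 0
  · exact ⟨0, 1, q, r, by simp [hp], by ring, by ring⟩
  · obtain ⟨s, hs⟩ := IsAlgClosed.exists_pow_nat_eq (q ^ 2 - 4 * p * r) (n := 2) (by norm_num)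
    refine ⟨p, (q + s) / 2, 1, (q - s) / (2 * p), by ring, by field_simp; ring, ?_⟩
    field_simp
    linear_combination hs

lemma exists_root_binary_quadratic (p q r : ℂ) :
    ∃ x y : ℂ, (x ≠ 0 ∨ y ≠ 0) ∧ p * x ^ 2 + q * (x * y) + r * y ^ 2 = 0 := by
  obtain ⟨α, β, γ, δ, rfl, rfl, rfl⟩ := exists_linear_factors p q r
  by_cases h : β ≠ 0 ∨ α ≠ 0
  · exact ⟨β, -α, by simpa using h, by ring⟩
  · push Not at h
    exact ⟨1, 0, by simp, by simp [h.1, h.2]⟩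

/-- Two binary quadratic forms over `ℂ` have a common nontrivial zero iff their resultant
vanishes. -/
lemma exists_common_root_iff_resultant_eq_zero (p q r p' q' r' : ℂ) :
    (∃ x y : ℂ, (x ≠ 0 ∨ y ≠ 0) ∧ p * x ^ 2 + q * (x * y) + r * y ^ 2 = 0 ∧
      p' * x ^ 2 + q' * (x * y) + r' * y ^ 2 = 0) ↔
    (p * r' - p' * r) ^ 2 - (p * q' - p' * q) * (q * r' - q' * r) = 0 := by
  constructor
  · rintro ⟨x, y, hxy, h, h'⟩
    by_cases hx : x = 0
    · subst hx
      have hy : y ≠ 0 := by simpa using hxy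
      obtain rfl : r = 0 := by simpa [hy] using h
      obtain rfl : r' = 0 := by simpa [hy] using h'
      ring
    by_cases hy : y = 0
    · subst hy
      obtain rfl : p = 0 := by simpa [hx] using h
      obtain rfl : p' = 0 := by simpa [hx] using h'
      ring
    have h₁ : (p * q' - p' * q) * x + (p * r' - p' * r) * y = 0 :=
      mul_left_cancel₀ hy (by linear_combination p * h' - p' * h)
    have h₂ : (p * r' - p' * r) * x + (q * r' - q' * r) * y = 0 :=
      mul_left_cancel₀ hx (by linear_combination r' * h - r * h')
    refine mul_left_cancel₀ hy ?_
    linear_combination (p * r' - p' * r) * h₁ - (p * q' - p' * q) * h₂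
  · intro h
    obtain ⟨α, β, γ, δ, rfl, rfl, rfl⟩ := exists_linear_factors p q r
    by_cases h₁ : β = 0 ∧ α = 0
    · obtain ⟨x, y, hxy, h'⟩ := exists_root_binary_quadratic p' q' r'
      exact ⟨x, y, hxy, by simp [h₁.1, h₁.2], h'⟩
    by_cases h₂ : δ = 0 ∧ γ = 0
    · obtain ⟨x, y, hxy, h'⟩ := exists_root_binary_quadratic p' q' r'
      exact ⟨x, y, hxy, by simp [h₂.1, h₂.2], h'⟩
    have hprod : (p' * β ^ 2 + q' * (β * -α) + r' * (-α) ^ 2) *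
        (p' * δ ^ 2 + q' * (δ * -γ) + r' * (-γ) ^ 2) = 0 := by
      linear_combination h
    rcases mul_eq_zero.mp hprod with h' | h'
    · exact ⟨β, -α, by rw [neg_ne_zero]; tauto, by ring, h'⟩
    · exact ⟨δ, -γ, by rw [neg_ne_zero]; tauto, by ring, h'⟩

lemma exists_mulVec_eq_smul_iff (M : Matrix (Fin 2) (Fin 2) ℂ) {x y : ℂ}
    (hxy : x ≠ 0 ∨ y ≠ 0) :
    (∃ a : ℂ, M *ᵥ ![x, y] = a • ![x, y]) ↔
      M 1 0 * x ^ 2 + (M 1 1 - M 0 0) * (x * y) + -M 0 1 * y ^ 2 = 0 := by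
  constructor
  · rintro ⟨a, ha⟩
    have h₀ : M 0 0 * x + M 0 1 * y = a * x := by
      simpa [Matrix.mulVec, dotProduct, Fin.sum_univ_two] using congrFun ha 0
    have h₁ : M 1 0 * x + M 1 1 * y = a * y := by
      simpa [Matrix.mulVec, dotProduct, Fin.sum_univ_two] using congrFun ha 1
    linear_combination x * h₁ - y * h₀
  · intro h
    rcases hxy with hx | hy
    · refine ⟨(M 0 0 * x + M 0 1 * y) / x, ?_⟩
      ext i
      fin_cases i <;> simp [Matrix.mulVec, dotProduct, Fin.sum_univ_two] <;> field_simp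
      linear_combination h
    · refine ⟨(M 1 0 * x + M 1 1 * y) / y, ?_⟩
      ext i
      fin_cases i <;> simp [Matrix.mulVec, dotProduct, Fin.sum_univ_two] <;> field_simp
      linear_combination -h

lemma hasCommonEigenvector_iff_exists_common_root
    (A B : Matrix.SpecialLinearGroup (Fin 2) ℂ) :
    HasCommonEigenvector A B ↔ ∃ x y : ℂ, (x ≠ 0 ∨ y ≠ 0) ∧
      A 1 0 * x ^ 2 + (A 1 1 - A 0 0) * (x * y) + -A 0 1 * y ^ 2 = 0 ∧
      B 1 0 * x ^ 2 + (B 1 1 - B 0 0) * (x * y) + -B 0 1 * y ^ 2 = 0 := by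
  have hne (x y : ℂ) : ![x, y] ≠ 0 ↔ x ≠ 0 ∨ y ≠ 0 := by
    simp [← not_and_or]
  constructor
  · rintro ⟨v, hv, hA, hB⟩
    have hv_eq : v = ![v 0, v 1] := by ext i; fin_cases i <;> rfl
    rw [hv_eq] at hv hA hB
    have hxy := (hne _ _).mp hv
    exact ⟨_, _, hxy, (exists_mulVec_eq_smul_iff _ hxy).mp hA,
      (exists_mulVec_eq_smul_iff _ hxy).mp hB⟩
  · rintro ⟨x, y, hxy, hA, hB⟩
    exact ⟨![x, y], (hne x y).mpr hxy, (exists_mulVec_eq_smul_iff _ hxy).mpr hA,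
      (exists_mulVec_eq_smul_iff _ hxy).mpr hB⟩

/-- Two matrices `A, B ∈ SL(2,ℂ)` have a common eigenvector iff `tr([A,B]) = 2`. -/
theorem hasCommonEigenvector_iff_trace_commutator_eq_two
    (A B : Matrix.SpecialLinearGroup (Fin 2) ℂ) :
    HasCommonEigenvector A B ↔ tr (A * B * A⁻¹ * B⁻¹) = 2 := by
  rw [hasCommonEigenvector_iff_exists_common_root, exists_common_root_iff_resultant_eq_zero,
    ← sub_eq_zero (a := tr _)]
  have hA : A 0 0 * A 1 1 - A 0 1 * A 1 0 = 1 := by rw [← Matrix.det_fin_two]; exact A.det_coe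
  have hB : B 0 0 * B 1 1 - B 0 1 * B 1 0 = 1 := by rw [← Matrix.det_fin_two]; exact B.det_coe
  have key : tr (A * B * A⁻¹ * B⁻¹) - 2 * ((A 0 0 * A 1 1 - A 0 1 * A 1 0) *
      (B 0 0 * B 1 1 - B 0 1 * B 1 0)) =
      (A 1 0 * -B 0 1 - B 1 0 * -A 0 1) ^ 2 -
        (A 1 0 * (B 1 1 - B 0 0) - B 1 0 * (A 1 1 - A 0 0)) *
        ((A 1 1 - A 0 0) * -B 0 1 - (B 1 1 - B 0 0) * -A 0 1) := by
    simp only [tr, Matrix.SpecialLinearGroup.coe_mul, Matrix.SpecialLinearGroup.coe_inv,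
      Matrix.adjugate_fin_two, Matrix.trace_fin_two, Matrix.mul_apply, Fin.sum_univ_two,
      Matrix.of_apply, Matrix.cons_val', Matrix.cons_val_zero, Matrix.cons_val_one,
      Matrix.cons_val_fin_one]
    ring
  rw [hA, hB, mul_one, mul_one] at key
  rw [key]
end

section
/- Let A, B, A', B' ∈ SL(2,ℂ) and assume tr([A,B]) ≠ 2. Then there exists a matrix M ∈ SL(2,ℂ) such that M·A·M⁻¹ = A' and M·B·M⁻¹ = B' if, and only if, tr(A) = tr(A'), tr(B) = tr(B') and tr(A·B) = tr(A'·B'). -/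
open Matrix in
/-- The Fricke trace identity for the commutator. -/
lemma tr_commutator (A B : Matrix.SpecialLinearGroup (Fin 2) ℂ) :
    tr (A * B * A⁻¹ * B⁻¹) =
      tr A ^ 2 + tr B ^ 2 + tr (A * B) ^ 2 - tr A * tr B * tr (A * B) - 2 := by
  have hA := A.det_coe
  have hB := B.det_coe
  rw [det_fin_two] at hA hB
  simp only [tr, Matrix.SpecialLinearGroup.coe_mul, Matrix.SpecialLinearGroup.coe_inv,
    adjugate_fin_two, trace_fin_two, mul_apply, Fin.sum_univ_two, of_apply, cons_val',
    cons_val_zero, cons_val_one, cons_val_fin_one]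
  linear_combination (B 0 0 + B 1 1) ^ 2 * hA + (A 0 0 + A 1 1) ^ 2 * hB
    - 2 * (B 0 0 * B 1 1 - B 0 1 * B 1 0) * hA - 2 * hB

open Matrix in
lemma tr_eq_two_of_mulVec_eq (C : Matrix.SpecialLinearGroup (Fin 2) ℂ) {v : Fin 2 → ℂ}
    (hv : v ≠ 0) (h : C.1 *ᵥ v = v) : tr C = 2 := by
  have hdet : (C.1 - 1).det = 0 :=
    exists_mulVec_eq_zero_iff.1 ⟨v, hv, by rw [sub_mulVec, h, one_mulVec, sub_self]⟩
  have hC := C.det_coe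
  rw [det_fin_two] at hdet hC
  simp at hdet
  simp only [tr, trace_fin_two]
  linear_combination hC - hdet

open Matrix in
/-- If `A` and `B` have a common eigenvector, then `tr [A, B] = 2`. -/
lemma tr_commutator_eq_two_of_eigenvector (A B : Matrix.SpecialLinearGroup (Fin 2) ℂ)
    {v : Fin 2 → ℂ} (hv : v ≠ 0) {l m : ℂ} (hl : l ≠ 0) (hm : m ≠ 0)
    (hA : A.1 *ᵥ v = l • v) (hB : B.1 *ᵥ v = m • v) : tr (A * B * A⁻¹ * B⁻¹) = 2 := by
  refine tr_eq_two_of_mulVec_eq _ hv ?_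
  have key : A * B * A⁻¹ * B⁻¹ * (B * A) = A * B := by group
  have h := congrArg (fun C : Matrix.SpecialLinearGroup (Fin 2) ℂ => C.1 *ᵥ v) key
  rw [Matrix.SpecialLinearGroup.coe_mul, Matrix.SpecialLinearGroup.coe_mul B,
    Matrix.SpecialLinearGroup.coe_mul A] at h
  simp only [← mulVec_mulVec, hA, hB, mulVec_smul, smul_smul] at h
  rw [mul_comm m l] at h
  exact smul_right_injective _ (mul_ne_zero hl hm) h

open Matrix in
/-- In the basis `v, B v`, where `v` is an eigenvector of `A * B`, a pair `A, B` with
`tr [A, B] ≠ 2` takes a form depending only on `tr A`, `tr B` and the eigenvalue. -/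
lemma exists_conj_normal_form (A B : Matrix.SpecialLinearGroup (Fin 2) ℂ)
    (h : tr (A * B * A⁻¹ * B⁻¹) ≠ 2) {s : ℂ} (hs : s ^ 2 - tr (A * B) * s + 1 = 0) :
    ∃ P : Matrix.SpecialLinearGroup (Fin 2) ℂ,
      A.1 * P.1 = P.1 * !![tr A, s; -s⁻¹, 0] ∧ B.1 * P.1 = P.1 * !![0, -1; 1, tr B] := by
  have hs0 : s ≠ 0 := by rintro rfl; simp at hs
  have hA := A.det_coe
  have hB := B.det_coe
  have hAB := (A * B).det_coe
  rw [det_fin_two] at hA hB hAB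
  obtain ⟨v, hv, hv'⟩ : ∃ v ≠ 0, ((A * B).1 - s • 1) *ᵥ v = 0 := by
    refine exists_mulVec_eq_zero_iff.2 ?_
    simp only [tr, trace_fin_two] at hs
    simp [det_fin_two] at hs hAB ⊢
    linear_combination hs + hAB
  have hABv : A.1 *ᵥ (B.1 *ᵥ v) = s • v := by
    rw [sub_mulVec, smul_mulVec, one_mulVec, sub_eq_zero] at hv'
    rw [mulVec_mulVec, ← hv', Matrix.SpecialLinearGroup.coe_mul]
  set w := B.1 *ᵥ v with hw
  have hd : v 0 * w 1 - w 0 * v 1 ≠ 0 := by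
    intro hd
    obtain ⟨m, hm⟩ : ∃ m : ℂ, w = m • v := by
      by_cases h0 : v 0 = 0
      · have h1 : v 1 ≠ 0 := fun h1 => hv (by ext i; fin_cases i <;> assumption)
        refine ⟨w 1 / v 1, ?_⟩
        ext i
        fin_cases i
        · have : w 0 = 0 := by simpa [h0, h1] using hd
          simp [h0, this]
        · simp [h1]
      · refine ⟨w 0 / v 0, ?_⟩
        ext i
        fin_cases i
        · simp [h0]
        · simp only [Fin.mk_one, Pi.smul_apply, smul_eq_mul]
          field_simp
          linear_combination hd
    have hm0 : m ≠ 0 := by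
      rintro rfl
      rw [hm, zero_smul, mulVec_zero] at hABv
      exact smul_ne_zero hs0 hv hABv.symm
    refine h (tr_commutator_eq_two_of_eigenvector A B hv (div_ne_zero hs0 hm0) hm0 ?_ hm)
    rw [hm, mulVec_smul] at hABv
    rw [div_eq_inv_mul, ← smul_smul, ← hABv, smul_smul, inv_mul_cancel₀ hm0, one_smul]
  obtain ⟨r, hr⟩ := IsAlgClosed.exists_pow_nat_eq (v 0 * w 1 - w 0 * v 1)⁻¹ two_pos
  have hdet : (r • !![v 0, w 0; v 1, w 1]).det = 1 := by
    rw [det_smul, Fintype.card_fin, hr, det_fin_two_of, inv_mul_cancel₀ hd]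
  have e0 := congrFun hABv 0
  have e1 := congrFun hABv 1
  have f0 := congrFun hw 0
  have f1 := congrFun hw 1
  simp only [mulVec, dotProduct, Fin.sum_univ_two, Pi.smul_apply, smul_eq_mul] at e0 e1 f0 f1
  refine ⟨⟨_, hdet⟩, ?_, ?_⟩
  · simp only [mul_smul_comm, smul_mul_assoc]
    congr 1
    ext i j
    fin_cases i <;> fin_cases j <;>
      simp [mul_apply, Fin.sum_univ_two, tr, trace_fin_two]
    · field_simp
      linear_combination A 1 1 * e0 - A 0 1 * e1 - w 0 * hA
    · linear_combination e0
    · field_simp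
      linear_combination A 0 0 * e1 - A 1 0 * e0 - w 1 * hA
    · linear_combination e1
  · simp only [mul_smul_comm, smul_mul_assoc]
    congr 1
    ext i j
    fin_cases i <;> fin_cases j <;>
      simp [mul_apply, Fin.sum_univ_two, tr, trace_fin_two]
    · linear_combination -f0
    · linear_combination B 0 1 * f1 - B 1 1 * f0 - v 0 * hB
    · linear_combination -f1
    · linear_combination B 1 0 * f0 - B 0 0 * f1 - v 1 * hB

lemma tr_conj (M A : Matrix.SpecialLinearGroup (Fin 2) ℂ) : tr (M * A * M⁻¹) = tr A := by
  rw [tr, Matrix.SpecialLinearGroup.coe_mul, Matrix.trace_mul_comm,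
    ← Matrix.SpecialLinearGroup.coe_mul, inv_mul_cancel_left, tr]

open Matrix in
/-- Two elements of `SL(2,ℂ)` with a common normal form are conjugate. -/
lemma conj_eq_of_mul_eq_mul {A A' P Q : Matrix.SpecialLinearGroup (Fin 2) ℂ}
    {X : Matrix (Fin 2) (Fin 2) ℂ} (hP : A.1 * P.1 = P.1 * X)
    (hQ : A'.1 * Q.1 = Q.1 * X) :
    Q * P⁻¹ * A * (Q * P⁻¹)⁻¹ = A' := by
  have hX : X = (P⁻¹ * A * P).1 := by
    rw [Matrix.SpecialLinearGroup.coe_mul, Matrix.SpecialLinearGroup.coe_mul, mul_assoc, hP,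
      ← mul_assoc, ← Matrix.SpecialLinearGroup.coe_mul, inv_mul_cancel,
      Matrix.SpecialLinearGroup.coe_one, one_mul]
  have h : A' * Q = Q * (P⁻¹ * A * P) := by
    apply Subtype.ext
    rw [Matrix.SpecialLinearGroup.coe_mul, Matrix.SpecialLinearGroup.coe_mul, hQ, hX]
  rw [eq_mul_inv_of_mul_eq h]
  group

/-- If `tr([A,B]) ≠ 2`, then there exists `M ∈ SL(2,ℂ)` with `M·A·M⁻¹ = A'` and
`M·B·M⁻¹ = B'` iff `tr A = tr A'`, `tr B = tr B'` and `tr (A·B) = tr (A'·B')`. -/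
theorem exists_conj_iff_traces_eq (A B A' B' : Matrix.SpecialLinearGroup (Fin 2) ℂ)
    (h : tr (A * B * A⁻¹ * B⁻¹) ≠ 2) :
    (∃ M : Matrix.SpecialLinearGroup (Fin 2) ℂ, M * A * M⁻¹ = A' ∧ M * B * M⁻¹ = B') ↔
      (tr A = tr A' ∧ tr B = tr B' ∧ tr (A * B) = tr (A' * B')) := by
  constructor
  · rintro ⟨M, rfl, rfl⟩
    refine ⟨(tr_conj M A).symm, (tr_conj M B).symm, ?_⟩
    rw [← tr_conj M (A * B)]
    congr 1
    group
  · rintro ⟨hA, hB, hAB⟩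
    have h' : tr (A' * B' * A'⁻¹ * B'⁻¹) ≠ 2 := by
      rwa [tr_commutator, ← hA, ← hB, ← hAB, ← tr_commutator]
    obtain ⟨d, hd⟩ := IsAlgClosed.exists_pow_nat_eq (tr (A * B) ^ 2 - 4) two_pos
    obtain ⟨s, hs⟩ : ∃ s : ℂ, s ^ 2 - tr (A * B) * s + 1 = 0 :=
      ⟨(tr (A * B) + d) / 2, by linear_combination hd / 4⟩
    obtain ⟨P, hPA, hPB⟩ := exists_conj_normal_form A B h hs
    obtain ⟨Q, hQA, hQB⟩ := exists_conj_normal_form A' B' h' (hAB ▸ hs)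
    rw [← hA] at hQA
    rw [← hB] at hQB
    exact ⟨Q * P⁻¹, conj_eq_of_mul_eq_mul hPA hQA, conj_eq_of_mul_eq_mul hPB hQB⟩
end

section
/- Let A, B ∈ SL(2,ℂ) with tr([A,B]) ≠ 2. Then there exists a matrix M ∈ SL(2,ℂ) such that M·A·M⁻¹ = A⁻¹, M·B·M⁻¹ = B⁻¹ and M² = −I. -/
/-- The commutator of two `2 × 2` matrices intertwines each of them with its adjugate. -/
theorem commutator_mul_eq_adjugate_mul {R : Type*} [CommRing R]
    (X Y : Matrix (Fin 2) (Fin 2) R) :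
    (X * Y - Y * X) * X = X.adjugate * (X * Y - Y * X) := by
  ext i j
  fin_cases i <;> fin_cases j <;>
    simp [Matrix.adjugate_fin_two, Matrix.mul_apply, Fin.sum_univ_two] <;> ring

/-- The square of the commutator of two `2 × 2` matrices is scalar. -/
theorem commutator_mul_self {R : Type*} [CommRing R] (X Y : Matrix (Fin 2) (Fin 2) R) :
    (X * Y - Y * X) * (X * Y - Y * X) = -(X * Y - Y * X).det • 1 := by
  ext i j
  fin_cases i <;> fin_cases j <;>
    simp [Matrix.det_fin_two, Matrix.mul_apply, Fin.sum_univ_two] <;> ring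

theorem det_sub_one_of_det_eq_one {R : Type*} [CommRing R] (X : Matrix (Fin 2) (Fin 2) R)
    (hX : X.det = 1) : (X - 1).det = 2 - X.trace := by
  rw [Matrix.det_fin_two] at hX
  simp [Matrix.det_fin_two, Matrix.trace_fin_two]
  linear_combination hX

theorem det_commutator_eq (A B : Matrix.SpecialLinearGroup (Fin 2) ℂ) :
    ((A : Matrix (Fin 2) (Fin 2) ℂ) * B - B * A).det = 2 - tr (A * B * A⁻¹ * B⁻¹) := by
  have hAB : A * B * A⁻¹ * B⁻¹ * (B * A) = A * B := by group
  have hAB' : (A : Matrix (Fin 2) (Fin 2) ℂ) * B - B * A =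
      (((A * B * A⁻¹ * B⁻¹ : Matrix.SpecialLinearGroup (Fin 2) ℂ) : Matrix (Fin 2) (Fin 2) ℂ) - 1) *
        ((B * A : Matrix.SpecialLinearGroup (Fin 2) ℂ) : Matrix (Fin 2) (Fin 2) ℂ) := by
    rw [sub_mul, one_mul, ← Matrix.SpecialLinearGroup.coe_mul, ← Matrix.SpecialLinearGroup.coe_mul,
      ← Matrix.SpecialLinearGroup.coe_mul, hAB]
  rw [hAB', Matrix.det_mul, Matrix.SpecialLinearGroup.det_coe, mul_one,
    det_sub_one_of_det_eq_one _ (Matrix.SpecialLinearGroup.det_coe _), tr]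

/-- If `tr([A,B]) ≠ 2`, there is `M ∈ SL(2,ℂ)` with `M·A·M⁻¹ = A⁻¹`,
`M·B·M⁻¹ = B⁻¹` and `M² = −I`. -/
theorem exists_involution_conj_inv (A B : Matrix.SpecialLinearGroup (Fin 2) ℂ)
    (h : tr (A * B * A⁻¹ * B⁻¹) ≠ 2) :
    ∃ M : Matrix.SpecialLinearGroup (Fin 2) ℂ,
      M * A * M⁻¹ = A⁻¹ ∧ M * B * M⁻¹ = B⁻¹ ∧
      ((M ^ 2 : Matrix.SpecialLinearGroup (Fin 2) ℂ) : Matrix (Fin 2) (Fin 2) ℂ) = -1 := by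
  set Q : Matrix (Fin 2) (Fin 2) ℂ := (A : Matrix (Fin 2) (Fin 2) ℂ) * B - B * A with hQ
  have hdet : Q.det ≠ 0 := by
    rw [hQ, det_commutator_eq]
    exact sub_ne_zero.2 h.symm
  obtain ⟨s, hs⟩ := IsAlgClosed.exists_eq_mul_self Q.det
  have hs0 : s ≠ 0 := by
    rintro rfl
    simp [hs] at hdet
  have hQA : Q * (A : Matrix (Fin 2) (Fin 2) ℂ) =
      (A : Matrix (Fin 2) (Fin 2) ℂ).adjugate * Q := commutator_mul_eq_adjugate_mul _ _
  have hQB : Q * (B : Matrix (Fin 2) (Fin 2) ℂ) =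
      (B : Matrix (Fin 2) (Fin 2) ℂ).adjugate * Q := by
    have hneg : Q = -((B : Matrix (Fin 2) (Fin 2) ℂ) * A - A * B) := (neg_sub _ _).symm
    rw [hneg, neg_mul, mul_neg, commutator_mul_eq_adjugate_mul]
  have hM : (s⁻¹ • Q).det = 1 := by
    rw [Matrix.det_smul, Fintype.card_fin, hs]
    field_simp
  obtain ⟨M, hMQ⟩ : ∃ M : Matrix.SpecialLinearGroup (Fin 2) ℂ,
      (M : Matrix (Fin 2) (Fin 2) ℂ) = s⁻¹ • Q := ⟨⟨s⁻¹ • Q, hM⟩, rfl⟩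
  refine ⟨M, ?_, ?_, ?_⟩
  · rw [mul_inv_eq_iff_eq_mul]
    apply Subtype.ext
    simp [Matrix.SpecialLinearGroup.coe_inv, hMQ, hQA]
  · rw [mul_inv_eq_iff_eq_mul]
    apply Subtype.ext
    simp [Matrix.SpecialLinearGroup.coe_inv, hMQ, hQB]
  · have hQQ : Q * Q = -Q.det • 1 := commutator_mul_self _ _
    rw [Matrix.SpecialLinearGroup.coe_pow, hMQ, sq, smul_mul_smul_comm, hQQ, hs, smul_smul]
    have hss : s⁻¹ * s⁻¹ * -(s * s) = -1 := by field_simp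
    rw [hss, neg_smul, one_smul]
end

section
/- Let A, B ∈ SL(2,ℂ) with tr([A,B]) ≠ 2. If M and M' are two matrices in SL(2,ℂ) each satisfying M·A·M⁻¹ = A⁻¹ and M·B·M⁻¹ = B⁻¹ (and likewise for M'), then M' = M or M' = −M. -/
/-- For `A, B` in `SL(2,ℂ)`, `2 - tr [A, B]` is the determinant of `A * B - B * A`. -/
theorem two_sub_tr_commutator (A B : Matrix.SpecialLinearGroup (Fin 2) ℂ) :
    2 - tr (A * B * A⁻¹ * B⁻¹) =
      ((A 0 0 - A 1 1) * B 0 1 - A 0 1 * (B 0 0 - B 1 1)) *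
        ((A 0 0 - A 1 1) * B 1 0 - A 1 0 * (B 0 0 - B 1 1)) -
      (A 0 1 * B 1 0 - A 1 0 * B 0 1) ^ 2 := by
  have hA := A.det_coe
  have hB := B.det_coe
  rw [Matrix.det_fin_two] at hA hB
  simp only [tr, Matrix.trace_fin_two, Matrix.SpecialLinearGroup.coe_mul,
    Matrix.SpecialLinearGroup.coe_inv, Matrix.adjugate_fin_two, Matrix.mul_apply,
    Fin.sum_univ_two, Matrix.of_apply, Matrix.cons_val', Matrix.cons_val_zero,
    Matrix.cons_val_one, Matrix.cons_val_fin_one]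
  linear_combination (-2 * (B 0 0 * B 1 1 - B 0 1 * B 1 0)) * hA - 2 * hB

/-- The off-diagonal and diagonal-difference entries of commuting `2 × 2` matrices are
proportional. -/
theorem Commute.fin_two_entries {N A : Matrix.SpecialLinearGroup (Fin 2) ℂ} (h : Commute N A) :
    N 0 1 * A 1 0 = N 1 0 * A 0 1 ∧
      N 0 1 * (A 0 0 - A 1 1) = A 0 1 * (N 0 0 - N 1 1) ∧
      N 1 0 * (A 0 0 - A 1 1) = A 1 0 * (N 0 0 - N 1 1) := by
  have e (i j : Fin 2) : (N * A) i j = (A * N) i j := by rw [h.eq]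
  simp only [Matrix.SpecialLinearGroup.coe_mul, Matrix.mul_apply, Fin.sum_univ_two] at e
  refine ⟨?_, ?_, ?_⟩
  · linear_combination e 0 0
  · linear_combination -e 0 1
  · linear_combination e 1 0

/-- An element of `SL(2,ℂ)` commuting with `A` and `B`, where `tr [A, B] ≠ 2`, is `1` or `-1`. -/
theorem eq_one_or_eq_neg_one_of_commute {A B N : Matrix.SpecialLinearGroup (Fin 2) ℂ}
    (h : tr (A * B * A⁻¹ * B⁻¹) ≠ 2) (hA : Commute N A) (hB : Commute N B) :
    N = 1 ∨ N = -1 := by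
  have ht : 2 - tr (A * B * A⁻¹ * B⁻¹) ≠ 0 := sub_ne_zero.mpr h.symm
  obtain ⟨a₁, a₂, a₃⟩ := hA.fin_two_entries
  obtain ⟨b₁, b₂, b₃⟩ := hB.fin_two_entries
  rw [two_sub_tr_commutator] at ht
  set p₁ := A 0 1 * B 1 0 - A 1 0 * B 0 1 with hp₁
  set p₂ := (A 0 0 - A 1 1) * B 0 1 - A 0 1 * (B 0 0 - B 1 1) with hp₂
  have hy : N 0 1 = 0 := by
    have h₁ : N 0 1 * p₁ = 0 := by
      rw [hp₁]; linear_combination A 0 1 * b₁ - B 0 1 * a₁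
    have h₂ : N 0 1 * p₂ = 0 := by
      rw [hp₂]; linear_combination B 0 1 * a₂ - A 0 1 * b₂
    refine (mul_eq_zero.mp ?_).resolve_right ht
    linear_combination ((A 0 0 - A 1 1) * B 1 0 - A 1 0 * (B 0 0 - B 1 1)) * h₂ - p₁ * h₁
  have hz : N 1 0 = 0 := by
    have h₁ : N 1 0 * p₁ = 0 := by
      rw [hp₁]; linear_combination A 1 0 * b₁ - B 1 0 * a₁
    have h₃ : N 1 0 * ((A 0 0 - A 1 1) * B 1 0 - A 1 0 * (B 0 0 - B 1 1)) = 0 := by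
      linear_combination B 1 0 * a₃ - A 1 0 * b₃
    refine (mul_eq_zero.mp ?_).resolve_right ht
    linear_combination p₂ * h₃ - p₁ * h₁
  rw [hy, zero_mul] at a₂ b₂
  rw [hz, zero_mul] at a₃ b₃
  have hxw : N 0 0 - N 1 1 = 0 := by
    refine (mul_eq_zero.mp ?_).resolve_right ht
    rw [hp₁, hp₂]
    grind
  have hdet := N.det_coe
  rw [Matrix.det_fin_two, hy, ← sub_eq_zero.mp hxw, zero_mul, sub_zero, mul_self_eq_one_iff]
    at hdet
  refine hdet.imp (fun hx => ?_) (fun hx => ?_) <;>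
  · ext i j
    fin_cases i <;> fin_cases j <;> simp [hx, hy, hz, ← sub_eq_zero.mp hxw]

/-- If `tr([A,B]) ≠ 2` and `M`, `M'` both conjugate `A` to `A⁻¹` and `B` to `B⁻¹`,
then `M' = M` or `M' = −M`. -/
theorem conj_inv_unique_up_to_sign (A B M M' : Matrix.SpecialLinearGroup (Fin 2) ℂ)
    (h : tr (A * B * A⁻¹ * B⁻¹) ≠ 2)
    (hM : M * A * M⁻¹ = A⁻¹ ∧ M * B * M⁻¹ = B⁻¹)
    (hM' : M' * A * M'⁻¹ = A⁻¹ ∧ M' * B * M'⁻¹ = B⁻¹) :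
    (M' : Matrix (Fin 2) (Fin 2) ℂ) = (M : Matrix (Fin 2) (Fin 2) ℂ) ∨
      (M' : Matrix (Fin 2) (Fin 2) ℂ) = -(M : Matrix (Fin 2) (Fin 2) ℂ) := by
  have key {X : Matrix.SpecialLinearGroup (Fin 2) ℂ} (hX : M * X * M⁻¹ = X⁻¹)
      (hX' : M' * X * M'⁻¹ = X⁻¹) : Commute (M⁻¹ * M') X := by
    have e : M' * X = M * X * M⁻¹ * M' := by rw [hX, ← hX', inv_mul_cancel_right]
    simp only [Commute, SemiconjBy, mul_assoc, e, inv_mul_cancel_left]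
  rcases eq_one_or_eq_neg_one_of_commute h (key hM.1 hM'.1) (key hM.2 hM'.2) with hN | hN
  · left
    rw [inv_mul_eq_one.mp hN]
  · right
    rw [inv_mul_eq_iff_eq_mul.mp hN, mul_neg, mul_one, Matrix.SpecialLinearGroup.coe_neg]
end

section
/- Let A, B, M ∈ SL(2,ℂ) satisfy M² = −I, M·A·M⁻¹ = A⁻¹ and M·B·M⁻¹ = B⁻¹, and assume A and B have no common eigenvector. Then tr(B·A·M) ≠ 0. -/
open Matrix

/-- A traceless element of `SL(2,ℂ)` squares to `-1`. -/
theorem sq_eq_neg_one_of_tr_eq_zero {X : Matrix.SpecialLinearGroup (Fin 2) ℂ} (h : tr X = 0) :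
    X ^ 2 = -1 := by
  have hdet := X.det_coe
  rw [Matrix.det_fin_two] at hdet
  rw [tr, Matrix.trace_fin_two] at h
  ext i j
  fin_cases i <;> fin_cases j <;>
    simp [pow_two, Matrix.mul_apply, Fin.sum_univ_two] <;> grind

/-- Every complex `2 × 2` matrix has an eigenvector. -/
theorem exists_eigenvector (A : Matrix (Fin 2) (Fin 2) ℂ) :
    ∃ v : Fin 2 → ℂ, v ≠ 0 ∧ ∃ a : ℂ, A *ᵥ v = a • v := by
  obtain ⟨a, ha⟩ := Module.End.exists_eigenvalue (Matrix.toLin' A)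
  obtain ⟨v, hv⟩ := ha.exists_hasEigenvector
  exact ⟨v, hv.2, a, by simpa using hv.apply_eq_smul⟩

/-- If two `2 × 2` matrices over a field commute, then the first one is scalar or the second one
is a linear polynomial in the first. -/
theorem eq_smul_one_or_eq_smul_add_smul_one_of_commute {K : Type*} [Field K]
    {A B : Matrix (Fin 2) (Fin 2) K} (h : A * B = B * A) :
    (∃ a : K, A = a • 1) ∨ ∃ x y : K, B = x • A + y • 1 := by
  have h00 := congrFun (congrFun h 0) 0
  have h01 := congrFun (congrFun h 0) 1
  have h10 := congrFun (congrFun h 1) 0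
  simp only [Matrix.mul_apply, Fin.sum_univ_two] at h00 h01 h10
  by_cases hb : A 0 1 = 0
  · by_cases hc : A 1 0 = 0
    · by_cases had : A 0 0 = A 1 1
      · refine Or.inl ⟨A 0 0, ?_⟩
        ext i j
        fin_cases i <;> fin_cases j <;> simp [hb, hc, had]
      · have hne := sub_ne_zero.mpr had
        refine Or.inr ⟨(B 0 0 - B 1 1) / (A 0 0 - A 1 1),
          B 0 0 - (B 0 0 - B 1 1) / (A 0 0 - A 1 1) * A 0 0, ?_⟩
        ext i j
        fin_cases i <;> fin_cases j <;> simp <;> grind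
    · refine Or.inr ⟨B 1 0 / A 1 0, B 0 0 - B 1 0 / A 1 0 * A 0 0, ?_⟩
      ext i j
      fin_cases i <;> fin_cases j <;> simp <;> grind
  · refine Or.inr ⟨B 0 1 / A 0 1, B 0 0 - B 0 1 / A 0 1 * A 0 0, ?_⟩
    ext i j
    fin_cases i <;> fin_cases j <;> simp <;> grind

/-- Commuting elements of `SL(2,ℂ)` have a common eigenvector. -/
theorem hasCommonEigenvector_of_commute {A B : Matrix.SpecialLinearGroup (Fin 2) ℂ}
    (h : A * B = B * A) : HasCommonEigenvector A B := by
  have h' : (A : Matrix (Fin 2) (Fin 2) ℂ) * B = B * A := by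
    simpa using congrArg Subtype.val h
  rcases eq_smul_one_or_eq_smul_add_smul_one_of_commute h' with ⟨a, ha⟩ | ⟨x, y, hxy⟩
  · obtain ⟨v, hv, hb⟩ := exists_eigenvector (B : Matrix (Fin 2) (Fin 2) ℂ)
    exact ⟨v, hv, ⟨a, by rw [ha, Matrix.smul_mulVec, Matrix.one_mulVec]⟩, hb⟩
  · obtain ⟨v, hv, a, ha⟩ := exists_eigenvector (A : Matrix (Fin 2) (Fin 2) ℂ)
    refine ⟨v, hv, ⟨a, ha⟩, x * a + y, ?_⟩
    rw [hxy, Matrix.add_mulVec, Matrix.smul_mulVec, Matrix.smul_mulVec, Matrix.one_mulVec, ha,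
      smul_smul, add_smul]

/-- If `M² = −I`, `M·A·M⁻¹ = A⁻¹`, `M·B·M⁻¹ = B⁻¹` and `A`, `B` have no common
eigenvector, then `tr(B·A·M) ≠ 0`. -/
theorem trace_BAM_ne_zero (A B M : Matrix.SpecialLinearGroup (Fin 2) ℂ)
    (hM2 : ((M ^ 2 : Matrix.SpecialLinearGroup (Fin 2) ℂ) : Matrix (Fin 2) (Fin 2) ℂ) = -1)
    (hA : M * A * M⁻¹ = A⁻¹) (hB : M * B * M⁻¹ = B⁻¹)
    (hirr : ¬ HasCommonEigenvector A B) :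
    tr (B * A * M) ≠ 0 := by
  intro htr
  have hM : M ^ 2 = -1 := by
    apply Subtype.ext
    simpa using hM2
  have hsq : (B * A * M) ^ 2 = -1 := sq_eq_neg_one_of_tr_eq_zero htr
  have key : (B * A * M) ^ 2 = B * A * (M * B * M⁻¹) * (M * A * M⁻¹) * M ^ 2 := by
    simp only [pow_two]
    group
  rw [hA, hB, hM, hsq, mul_neg, mul_one, neg_inj] at key
  rw [eq_comm, mul_inv_eq_one, mul_inv_eq_iff_eq_mul] at key
  exact hirr (hasCommonEigenvector_of_commute key.symm)
end

section
/- Let A, B, D₁, D₂, M ∈ SL(2,ℂ) satisfy A·B = D₁·B·A·D₂, M² = −I, M·A·M⁻¹ = A⁻¹, M·B·M⁻¹ = B⁻¹ and M·D₁·M⁻¹ = D₂. Define M₀ = −A·M, M₁ = A·B·D₂⁻¹·M, M_t = D₁, M_λ = −B·M and M_∞ = M. Then M₀·M₁·M_t·M_λ·M_∞ = I, the traces tr(M₀) = tr(M₁) = tr(M_λ) = tr(M_∞) = 0, and moreover M₁·M_t·M_λ = A, M_λ·M_∞ = B, M_t = D₁ and M_∞·M_t·M_∞⁻¹ = D₂.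 -/
open Matrix.SpecialLinearGroup in
/-- An element of `SL(2,ℂ)` whose square is `-1` has trace zero. -/
theorem tr_eq_zero_of_mul_self (X : Matrix.SpecialLinearGroup (Fin 2) ℂ) (h : X * X = -1) :
    tr X = 0 := by
  have hinv : X⁻¹ = -X := inv_eq_of_mul_eq_one_right (by rw [mul_neg, h, neg_neg])
  have hentry := congrArg (fun Y : Matrix.SpecialLinearGroup (Fin 2) ℂ => Y.1 0 0) hinv
  have hsum : X.1 1 1 = -X.1 0 0 := by
    simpa [coe_inv, Matrix.adjugate_fin_two] using hentry
  simp only [tr, Matrix.trace_fin_two]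
  exact (congrArg (X.1 0 0 + ·) hsum).trans (add_neg_cancel _)

/-- Given `A·B = D₁·B·A·D₂`, `M² = −I`, `M·A·M⁻¹ = A⁻¹`, `M·B·M⁻¹ = B⁻¹` and
`M·D₁·M⁻¹ = D₂`, the matrices `M₀ = −A·M`, `M₁ = A·B·D₂⁻¹·M`, `M_t = D₁`,
`M_λ = −B·M`, `M_∞ = M` give a representation of the five-punctured sphere
mapping to `(A, B, D₁, D₂)`. -/
theorem inverse_of_elliptic_pullback
    (A B D₁ D₂ M : Matrix.SpecialLinearGroup (Fin 2) ℂ)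
    (hrel : A * B = D₁ * B * A * D₂)
    (hM2 : ((M ^ 2 : Matrix.SpecialLinearGroup (Fin 2) ℂ) : Matrix (Fin 2) (Fin 2) ℂ) = -1)
    (hA : M * A * M⁻¹ = A⁻¹) (hB : M * B * M⁻¹ = B⁻¹) (hD : M * D₁ * M⁻¹ = D₂)
    -- the matrices of the statement, defined at the level of `Matrix (Fin 2) (Fin 2) ℂ`
    (M₀ M₁ Mt Ml Minf : Matrix.SpecialLinearGroup (Fin 2) ℂ)
    (hM₀ : (M₀ : Matrix (Fin 2) (Fin 2) ℂ) = -((A * M : Matrix.SpecialLinearGroup (Fin 2) ℂ) : Matrix (Fin 2) (Fin 2) ℂ))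
    (hM₁ : M₁ = A * B * D₂⁻¹ * M)
    (hMt : Mt = D₁)
    (hMl : (Ml : Matrix (Fin 2) (Fin 2) ℂ) = -((B * M : Matrix.SpecialLinearGroup (Fin 2) ℂ) : Matrix (Fin 2) (Fin 2) ℂ))
    (hMinf : Minf = M) :
    M₀ * M₁ * Mt * Ml * Minf = 1 ∧
    (tr M₀ = 0 ∧ tr M₁ = 0 ∧ tr Ml = 0 ∧ tr Minf = 0) ∧
    (M₁ * Mt * Ml = A ∧ Ml * Minf = B ∧ Mt = D₁ ∧ Minf * Mt * Minf⁻¹ = D₂) := by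
  have hM : M * M = -1 := by
    apply Subtype.ext
    simpa [pow_two] using hM2
  have h₀ : M₀ = -(A * M) := Subtype.ext (by simpa using hM₀)
  have hl : Ml = -(B * M) := Subtype.ext (by simpa using hMl)
  have hA' : M * A = A⁻¹ * M := mul_inv_eq_iff_eq_mul.mp hA
  have hB' : M * B = B⁻¹ * M := mul_inv_eq_iff_eq_mul.mp hB
  have hD' : M * D₁ = D₂ * M := mul_inv_eq_iff_eq_mul.mp hD
  have hD₂ : M * D₂⁻¹ * M = -D₁⁻¹ := by
    calc M * D₂⁻¹ * M = M * M * D₁⁻¹ := by rw [← hD]; group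
      _ = -D₁⁻¹ := by rw [hM, neg_one_mul]
  have hAM : A * M * (A * M) = -1 := by
    rw [mul_assoc, ← mul_assoc M, hA', mul_assoc, hM, mul_inv_cancel_left]
  have hBM : B * M * (B * M) = -1 := by
    rw [mul_assoc, ← mul_assoc M, hB', mul_assoc, hM, mul_inv_cancel_left]
  have hABD : A * B * D₂⁻¹ = D₁ * B * A := mul_inv_eq_iff_eq_mul.mpr hrel
  have hM₁sq : M₁ * M₁ = -1 := by
    calc M₁ * M₁ = A * B * D₂⁻¹ * (M * A) * B * (D₂⁻¹ * M) := by rw [hM₁]; group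
      _ = D₁ * B * A * A⁻¹ * (M * B) * (D₂⁻¹ * M) := by rw [hA', hABD]; group
      _ = D₁ * (M * D₂⁻¹ * M) := by rw [hB']; group
      _ = -1 := by rw [hD₂, mul_neg, mul_inv_cancel]
  have hprodA : M₁ * Mt * Ml = A := by
    calc M₁ * Mt * Ml = -(A * B * D₂⁻¹ * (M * D₁) * (B * M)) := by
          rw [hM₁, hMt, hl, mul_neg]; group
      _ = -(A * (B * M * (B * M))) := by rw [hD']; group
      _ = A := by rw [hBM, mul_neg, mul_one, neg_neg]
  refine ⟨?_, ⟨?_, ?_, ?_, ?_⟩, hprodA, ?_, hMt, ?_⟩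
  · calc M₀ * M₁ * Mt * Ml * Minf = M₀ * (M₁ * Mt * Ml) * Minf := by group
      _ = 1 := by rw [hprodA, h₀, hMinf, neg_mul, neg_mul, mul_assoc, hAM, neg_neg]
  · exact tr_eq_zero_of_mul_self _ (by rw [h₀, neg_mul_neg, hAM])
  · exact tr_eq_zero_of_mul_self _ hM₁sq
  · exact tr_eq_zero_of_mul_self _ (by rw [hl, neg_mul_neg, hBM])
  · exact tr_eq_zero_of_mul_self _ (by rw [hMinf, hM])
  · rw [hl, hMinf, neg_mul, mul_assoc, hM, mul_neg, mul_one, neg_neg]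
  · rw [hMinf, hMt, hD]
end

section
/- Let M₀, M₁, M_t, M_λ, M_∞ ∈ SL(2,ℂ) satisfy M₀·M₁·M_t·M_λ·M_∞ = I and Mᵢ² = −I for i ∈ {0, 1, λ, ∞}. Define A = M₁·M_t·M_λ, B = M_λ·M_∞, D₁ = M_t and D₂ = M_∞·M_t·M_∞⁻¹. Then A·B = D₁·B·A·D₂. -/
/-- An element of `SL(2,ℂ)` whose square is `-I` has inverse equal to its negative. -/
theorem inv_eq_neg_of_coe_sq_eq_neg_one (M : Matrix.SpecialLinearGroup (Fin 2) ℂ)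
    (h : ((M ^ 2 : Matrix.SpecialLinearGroup (Fin 2) ℂ) : Matrix (Fin 2) (Fin 2) ℂ) = -1) :
    M⁻¹ = -M := by
  have hM : M * M = -1 := by
    rw [← sq]
    exact Subtype.ext (by simpa using h)
  exact inv_eq_of_mul_eq_one_right (by rw [mul_neg, hM, neg_neg])

/-- Given `M₀·M₁·M_t·M_λ·M_∞ = I` in `SL(2,ℂ)` with `Mᵢ² = −I` for
`i ∈ {0, 1, λ, ∞}`, the matrices `A = M₁·M_t·M_λ`, `B = M_λ·M_∞`, `D₁ = M_t`
and `D₂ = M_∞·M_t·M_∞⁻¹` satisfy `A·B = D₁·B·A·D₂`. -/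
theorem elliptic_pullback_relation
    (M₀ M₁ Mt Ml Minf : Matrix.SpecialLinearGroup (Fin 2) ℂ)
    (hprod : M₀ * M₁ * Mt * Ml * Minf = 1)
    (h0 : ((M₀ ^ 2 : Matrix.SpecialLinearGroup (Fin 2) ℂ) : Matrix (Fin 2) (Fin 2) ℂ) = -1)
    (h1 : ((M₁ ^ 2 : Matrix.SpecialLinearGroup (Fin 2) ℂ) : Matrix (Fin 2) (Fin 2) ℂ) = -1)
    (hl : ((Ml ^ 2 : Matrix.SpecialLinearGroup (Fin 2) ℂ) : Matrix (Fin 2) (Fin 2) ℂ) = -1)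
    (hinf : ((Minf ^ 2 : Matrix.SpecialLinearGroup (Fin 2) ℂ) : Matrix (Fin 2) (Fin 2) ℂ) = -1) :
    (M₁ * Mt * Ml) * (Ml * Minf) =
      Mt * (Ml * Minf) * (M₁ * Mt * Ml) * (Minf * Mt * Minf⁻¹) := by
  have inv₀ := inv_eq_neg_of_coe_sq_eq_neg_one M₀ h0
  have inv₁ := inv_eq_neg_of_coe_sq_eq_neg_one M₁ h1
  have invl := inv_eq_neg_of_coe_sq_eq_neg_one Ml hl
  have invinf := inv_eq_neg_of_coe_sq_eq_neg_one Minf hinf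
  have prod₀ : M₁ * Mt * Ml * Minf = -M₀ := by
    rw [← inv₀]
    exact (inv_eq_of_mul_eq_one_right (by simpa only [mul_assoc] using hprod)).symm
  have prod₁ : Mt * Ml * Minf * M₀ = -M₁ := by
    rw [← inv₁]
    refine (inv_eq_of_mul_eq_one_right ?_).symm
    calc M₁ * (Mt * Ml * Minf * M₀) = (M₁ * Mt * Ml * Minf) * M₀ := by group
      _ = 1 := by rw [prod₀, ← inv₀, inv_mul_cancel]
  have sql : Ml * Ml = -1 := by
    rw [← neg_eq_iff_eq_neg, ← mul_neg, ← invl, mul_inv_cancel]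
  calc (M₁ * Mt * Ml) * (Ml * Minf) = M₁ * Mt * (Ml * Ml) * Minf := by group
    _ = M₁ * Mt * Minf⁻¹ := by rw [sql, invinf]; simp
    _ = -(Mt * Ml * Minf * M₀) * Mt * Minf⁻¹ := by rw [prod₁, neg_neg]
    _ = (Mt * Ml * Minf) * (M₁ * Mt * Ml * Minf) * Mt * Minf⁻¹ := by rw [prod₀, mul_neg]
    _ = Mt * (Ml * Minf) * (M₁ * Mt * Ml) * (Minf * Mt * Minf⁻¹) := by
      simp only [mul_assoc]
end

section
/- Let Γ be the group with presentation Γ = ⟨γ₀, γ₁, γ_t, γ_λ, γ_∞ | γ₀·γ₁·γ_t·γ_λ·γ_∞ = 1, γ₀² = γ₁² = γ_λ² = γ_∞² = 1⟩. Then the elements α = γ₁·γ_t·γ_λ, β = γ_λ·γ_∞, δ₁ = γ_t and δ₂ = γ_∞·γ_t·γ_∞⁻¹ of Γ satisfy the relation α·β = δ₁·β·α·δ₂. -/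
/-- Generators of the orbifold fundamental group of the five-punctured sphere
with four orbifold points of order two. -/
inductive Gen : Type
  | g0 | g1 | gt | gl | gi
  deriving DecidableEq

open FreeGroup in
/-- The relations: `γ₀·γ₁·γ_t·γ_λ·γ_∞ = 1` and `γ₀² = γ₁² = γ_λ² = γ_∞² = 1`. -/
def rels : Set (FreeGroup Gen) :=
  { of Gen.g0 * of Gen.g1 * of Gen.gt * of Gen.gl * of Gen.gi,
    of Gen.g0 ^ 2, of Gen.g1 ^ 2, of Gen.gl ^ 2, of Gen.gi ^ 2 }

/-- The orbifold fundamental group `Γ`. -/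
abbrev Γ : Type := PresentedGroup rels

/-- The relation `α·β = δ₁·β·α·δ₂` holds for any elements of a group satisfying the relations
of `Γ`. -/
theorem mul_eq_of_sphere_relations {G : Type*} [Group G] {a b t l i : G}
    (h : a * b * t * l * i = 1) (ha : a ^ 2 = 1) (hb : b ^ 2 = 1) (hl : l ^ 2 = 1)
    (hi : i ^ 2 = 1) :
    b * t * l * (l * i) = t * (l * i) * (b * t * l) * (i * t * i⁻¹) := by
  have hinv : i⁻¹ = i := inv_eq_of_mul_eq_one_left (by rwa [← sq])
  have hprod : b * t * l * i = a⁻¹ := eq_inv_of_mul_eq_one_right (by simpa only [mul_assoc] using h)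
  have hsq : (b * t * l * i) * (b * t * l * i) = 1 := by
    rw [hprod, ← sq, inv_pow, ha, inv_one]
  have hconj : t * l * i * (b * t * l * i) = b := by
    calc t * l * i * (b * t * l * i) = b⁻¹ * ((b * t * l * i) * (b * t * l * i)) := by group
      _ = b := by rw [hsq, mul_one]; exact inv_eq_of_mul_eq_one_left (by rwa [← sq])
  calc b * t * l * (l * i) = b * t * l ^ 2 * i := by simp only [sq, mul_assoc]
    _ = b * t * i := by rw [hl, mul_one]
    _ = t * l * i * (b * t * l * i) * t * i := by rw [hconj]
    _ = t * (l * i) * (b * t * l) * (i * t * i⁻¹) := by rw [hinv]; simp only [mul_assoc]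

/-- In `Γ`, the elements `α = γ₁·γ_t·γ_λ`, `β = γ_λ·γ_∞`, `δ₁ = γ_t` and
`δ₂ = γ_∞·γ_t·γ_∞⁻¹` satisfy `α·β = δ₁·β·α·δ₂`. -/
theorem twice_punctured_torus_relation :
    let γ : Gen → Γ := PresentedGroup.of
    let α : Γ := γ Gen.g1 * γ Gen.gt * γ Gen.gl
    let β : Γ := γ Gen.gl * γ Gen.gi
    let δ₁ : Γ := γ Gen.gt
    let δ₂ : Γ := γ Gen.gi * γ Gen.gt * (γ Gen.gi)⁻¹
    α * β = δ₁ * β * α * δ₂ :=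
  mul_eq_of_sphere_relations (a := PresentedGroup.of Gen.g0)
    (PresentedGroup.one_of_mem (rels := rels)
      (x := FreeGroup.of Gen.g0 * FreeGroup.of Gen.g1 * FreeGroup.of Gen.gt * FreeGroup.of Gen.gl *
        FreeGroup.of Gen.gi) (by simp [rels]))
    (PresentedGroup.one_of_mem (rels := rels) (x := FreeGroup.of Gen.g0 ^ 2) (by simp [rels]))
    (PresentedGroup.one_of_mem (rels := rels) (x := FreeGroup.of Gen.g1 ^ 2) (by simp [rels]))
    (PresentedGroup.one_of_mem (rels := rels) (x := FreeGroup.of Gen.gl ^ 2) (by simp [rels]))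
    (PresentedGroup.one_of_mem (rels := rels) (x := FreeGroup.of Gen.gi ^ 2) (by simp [rels]))
end
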